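/- Let c_1 ≤ c_2 ≤ … ≤ c_n be the centres of n unit intervals. Then the infimum of Σ_{i=1}^n |d_i| over all d ∈ ℝⁿ such that the moved unit intervals [c_i + d_i − 1/2, c_i + d_i + 1/2] are pairwise disjoint (the resulting intersection graph is edgeless) equals the infimum of Σ_{i=1}^n |d_i| over all d ∈ ℝⁿ satisfying (c_{i+1} + d_{i+1}) − (c_i + d_i) > 1 for all 1 ≤ i ≤ n − 1. -/

import Mathlib

theorem abs_sub_add_abs_sub_le_of_le {a b x y : ℝ} (hab : a ≤ b) (hxy : x ≤ y) :
    |x - a| + |y - b| ≤ |y - a| + |x - b| := by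
  grind

theorem sum_comp_swap_sub_sum {ι : Type*} [Fintype ι] [DecidableEq ι] {i j : ι} (hij : i ≠ j)
    (f : ι → ℝ → ℝ) (y : ι → ℝ) :
    ∑ k, f k (y (Equiv.swap i j k)) - ∑ k, f k (y k) =
      (f i (y j) + f j (y i)) - (f i (y i) + f j (y j)) := by
  rw [← Finset.sum_sub_distrib, Fintype.sum_eq_add i j hij]
  · simp only [Equiv.swap_apply_left, Equiv.swap_apply_right]
    ring
  · rintro k ⟨hi, hj⟩
    rw [Equiv.swap_apply_of_ne_of_ne hi hj, sub_self]

/-- Sorting the targets does not increase the cost of matching them to sorted sources. -/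
theorem exists_perm_monotone_sum_abs_sub_le {n : ℕ} {c : Fin n → ℝ} (hc : Monotone c)
    (y : Fin n → ℝ) :
    ∃ σ : Equiv.Perm (Fin n), Monotone (y ∘ σ) ∧ ∑ i, |y (σ i) - c i| ≤ ∑ i, |y i - c i| := by
  classical
  let S : Finset (Equiv.Perm (Fin n)) :=
    Finset.univ.filter fun σ => ∑ i, |y (σ i) - c i| ≤ ∑ i, |y i - c i|
  have hS : S.Nonempty := ⟨1, by simp [S]⟩
  obtain ⟨σ, hσ, hmax⟩ := S.exists_max_image
    (fun σ => ∑ i : Fin n, ((i : ℕ) : ℝ) * y (σ i)) hS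
  have hcost : ∑ i, |y (σ i) - c i| ≤ ∑ i, |y i - c i| := (Finset.mem_filter.1 hσ).2
  refine ⟨σ, fun i j hij => ?_, hcost⟩
  by_contra! hlt
  simp only [Function.comp_apply] at hlt
  have hne : i ≠ j := by rintro rfl; exact lt_irrefl _ hlt
  have hij' : ((i : ℕ) : ℝ) < ((j : ℕ) : ℝ) := by exact_mod_cast lt_of_le_of_ne hij hne
  have hswap := sum_comp_swap_sub_sum hne (fun k t => |t - c k|) (fun k => y (σ k))
  have hle := abs_sub_add_abs_sub_le_of_le (hc hij) hlt.le
  have hmem : σ * Equiv.swap i j ∈ S := by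
    simp only [S, Finset.mem_filter, Finset.mem_univ, true_and, Equiv.Perm.mul_apply]
    linarith
  have hgain := sum_comp_swap_sub_sum hne (fun k t => ((k : ℕ) : ℝ) * t) (fun k => y (σ k))
  have hbest := hmax _ hmem
  simp only [Equiv.Perm.mul_apply] at hbest
  nlinarith [mul_pos (sub_pos.2 hij') (sub_pos.2 hlt)]

theorem one_lt_sub_of_lt_of_consecutive {n : ℕ} {z : Fin n → ℝ}
    (hz : ∀ i : ℕ, ∀ h : i + 1 < n, 1 < z ⟨i + 1, h⟩ - z ⟨i, Nat.lt_of_succ_lt h⟩)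
    {i j : Fin n} (hij : i < j) : 1 < z j - z i := by
  obtain ⟨i, hi⟩ := i
  obtain ⟨j, hj⟩ := j
  have hij' : i + 1 ≤ j := hij
  clear hij
  induction j, hij' using Nat.le_induction with
  | base => exact hz i hj
  | succ j _ ih =>
    have h₁ := ih (by omega)
    have h₂ := hz j hj
    linarith

/-- Let `c 0 ≤ … ≤ c (n-1)` be the centres of `n` unit intervals.  The
infimum of `∑ |d i|` over all displacement vectors `d` making the moved unit intervals
pairwise disjoint (edgeless intersection graph) equals the infimum of `∑ |d i|` over
all `d` satisfying `(c (i+1) + d (i+1)) - (c i + d i) > 1` for all `i`. -/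
theorem edgeless_LP_infimum_eq
    (n : ℕ) (c : Fin n → ℝ) (hc : Monotone c) :
    sInf {t : ℝ | ∃ d : Fin n → ℝ,
        (∀ i j : Fin n, i ≠ j → 1 < |(c i + d i) - (c j + d j)|) ∧
        t = ∑ i, |d i|} =
    sInf {t : ℝ | ∃ d : Fin n → ℝ,
        (∀ i : ℕ, ∀ h : i + 1 < n,
          1 < (c ⟨i + 1, h⟩ + d ⟨i + 1, h⟩) - (c ⟨i, by omega⟩ + d ⟨i, by omega⟩)) ∧
        t = ∑ i, |d i|} := by
  refine le_antisymm (csInf_le_csInf ⟨0, ?_⟩ ?_ ?_) (le_csInf ?_ ?_)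
  · rintro t ⟨d, -, rfl⟩
    exact Finset.sum_nonneg fun i _ => abs_nonneg (d i)
  · refine ⟨_, fun i => 2 * ((i : ℕ) : ℝ) - c i, fun i h => ?_, rfl⟩
    push_cast
    linarith
  · rintro t ⟨d, hd, rfl⟩
    refine ⟨d, fun i j hij => ?_, rfl⟩
    rcases lt_or_gt_of_ne hij with h | h
    · have := one_lt_sub_of_lt_of_consecutive (z := fun k => c k + d k) hd h
      rw [abs_sub_comm]
      exact this.trans_le (le_abs_self _)
    · have := one_lt_sub_of_lt_of_consecutive (z := fun k => c k + d k) hd h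
      exact this.trans_le (le_abs_self _)
  · refine ⟨_, fun i => 2 * ((i : ℕ) : ℝ) - c i, fun i j hij => ?_, rfl⟩
    have hz := fun {i j : Fin n} (h : i < j) => one_lt_sub_of_lt_of_consecutive
      (z := fun k : Fin n => 2 * ((k : ℕ) : ℝ)) (fun i h => by push_cast; linarith) h
    simp only [add_sub_cancel]
    rcases lt_or_gt_of_ne hij with h | h
    · rw [abs_sub_comm]
      exact (hz h).trans_le (le_abs_self _)
    · exact (hz h).trans_le (le_abs_self _)
  · rintro t ⟨d, hd, rfl⟩
    obtain ⟨σ, hmono, hcost⟩ := exists_perm_monotone_sum_abs_sub_le hc fun k => c k + d k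
    simp only [add_sub_cancel_left] at hcost
    refine le_trans (csInf_le ⟨0, ?_⟩ ⟨fun i => c (σ i) + d (σ i) - c i, fun i h => ?_, rfl⟩) hcost
    · rintro t ⟨d, -, rfl⟩
      exact Finset.sum_nonneg fun i _ => abs_nonneg (d i)
    · have hle : (⟨i, by omega⟩ : Fin n) ≤ ⟨i + 1, h⟩ := Fin.mk_le_mk.2 (Nat.le_succ i)
      have hsep := hd (σ ⟨i + 1, h⟩) (σ ⟨i, by omega⟩) (σ.injective.ne (by simp))
      have hnonneg := sub_nonneg.2 (hmono hle)
      simp only [Function.comp_apply] at hnonneg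
      rw [abs_of_nonneg hnonneg] at hsep
      simpa only [add_sub_cancel] using hsep
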